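/- There exists a pair of linear orders X and Y that are not order-isomorphic but are both left-hand and right-hand divisors of one another: there exist linear orders A, A', B, B' such that X ≅ A ×ₗ Y, Y ≅ A' ×ₗ X, X ≅ Y ×ₗ B, and Y ≅ X ×ₗ B' (all isomorphisms being order isomorphisms). -/

import Mathlib

open Filter

/-! ### Infinitely long words, ordered by their last difference -/

/-- Sequences eventually equal to `s`, ordered by the last place where they differ. -/
abbrev EventuallyEqTo (s : ℕ → ℕ) : Type :=
  {t : Colex (ℕ → ℕ) // ofColex t =ᶠ[atTop] s}

theorem colex_le_total {a b : Colex (ℕ → ℕ)} (h : ofColex a =ᶠ[atTop] ofColex b) :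
    a ≤ b ∨ b ≤ a := by
  by_cases hab : a = b
  · exact Or.inl hab.le
  obtain ⟨N, hN⟩ := eventually_atTop.1 h
  have hne : ∃ n, n ≤ N ∧ a n ≠ b n := by
    obtain ⟨n, hn⟩ := Function.ne_iff.1 hab
    exact ⟨n, by by_contra hlt; exact hn (hN n (by omega)), hn⟩
  classical
  obtain ⟨n₀, hn₀, hd₀⟩ := hne
  have hspec := Nat.findGreatest_spec (P := fun n ↦ a n ≠ b n) hn₀ hd₀
  have heq : ∀ m > Nat.findGreatest (fun n ↦ a n ≠ b n) N, a m = b m := by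
    intro m hm
    by_cases hmN : m ≤ N
    · by_contra hne
      exact Nat.findGreatest_is_greatest hm hmN hne
    · exact hN m (by omega)
  rcases lt_or_gt_of_ne hspec with hlt | hlt
  · exact Or.inl (le_of_lt ⟨_, fun j hj ↦ heq j hj, hlt⟩)
  · exact Or.inr (le_of_lt ⟨_, fun j hj ↦ (heq j hj).symm, hlt⟩)

noncomputable instance EventuallyEqTo.linearOrder (s : ℕ → ℕ) : LinearOrder (EventuallyEqTo s) where
  le_total a b := colex_le_total (a.2.trans b.2.symm)
  toDecidableLE := Classical.decRel _

theorem colex_lt_iff_tail {a b : Colex (ℕ → ℕ)} :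
    a < b ↔ toColex (fun n ↦ a (n + 1)) < toColex (fun n ↦ b (n + 1)) ∨
      toColex (fun n ↦ a (n + 1)) = toColex (fun n ↦ b (n + 1)) ∧ a 0 < b 0 := by
  constructor
  · rintro ⟨n, hn, hlt⟩
    cases n with
    | zero => exact Or.inr ⟨funext fun m ↦ hn (m + 1) (Nat.succ_pos m), hlt⟩
    | succ n => exact Or.inl ⟨n, fun m hm ↦ hn (m + 1) (Nat.succ_lt_succ hm), hlt⟩
  · rintro (⟨n, hn, hlt⟩ | ⟨h, hlt⟩)
    · refine ⟨n + 1, fun m hm ↦ ?_, hlt⟩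
      cases m with
      | zero => exact absurd hm (Nat.not_lt_zero _)
      | succ m => exact hn m (Nat.lt_of_succ_lt_succ hm)
    · refine ⟨0, fun m hm ↦ ?_, hlt⟩
      cases m with
      | zero => exact absurd hm (lt_irrefl _)
      | succ m => exact congrFun h m

theorem eventuallyEq_tail_iff {a s : ℕ → ℕ} :
    (fun n ↦ a (n + 1)) =ᶠ[atTop] (fun n ↦ s (n + 1)) ↔ a =ᶠ[atTop] s := by
  change (∀ᶠ n in atTop, a (n + 1) = s (n + 1)) ↔ ∀ᶠ n in atTop, a n = s n
  conv_rhs => rw [← map_add_atTop_eq_nat 1, eventually_map]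

/-- Splitting off the first letter of a word. -/
noncomputable def EventuallyEqTo.tailHead (s : ℕ → ℕ) :
    EventuallyEqTo s ≃o Lex (EventuallyEqTo (fun n ↦ s (n + 1)) × ℕ) :=
  StrictMono.orderIsoOfSurjective
    (fun t ↦ toLex (⟨toColex fun n ↦ t.1 (n + 1), eventuallyEq_tail_iff.2 t.2⟩, t.1 0))
    (fun a b hab ↦ by
      rcases colex_lt_iff_tail.1 (show a.1 < b.1 from hab) with h | ⟨h, h0⟩
      · exact Prod.Lex.lt_iff.2 (Or.inl h)
      · exact Prod.Lex.lt_iff.2 (Or.inr ⟨Subtype.ext h, h0⟩))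
    (fun p ↦ ⟨⟨toColex fun n ↦ Nat.casesOn n (ofLex p).2 fun m ↦ (ofLex p).1.1 m,
      eventuallyEq_tail_iff.1 (ofLex p).1.2⟩, rfl⟩)

section RightCancel

variable {P Q : Type*} [LinearOrder P] [LinearOrder Q]

theorem not_covBy_toLex_zero (a : Lex (P × ℕ)) (p : P) : ¬ a ⋖ toLex (p, 0) := by
  obtain ⟨q, m⟩ := a
  intro h
  rcases Prod.Lex.lt_iff.1 h.1 with hlt | ⟨-, hlt⟩
  · exact h.2 (c := toLex (q, m + 1)) (Prod.Lex.lt_iff.2 (Or.inr ⟨rfl, Nat.lt_succ_self m⟩))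
      (Prod.Lex.lt_iff.2 (Or.inl hlt))
  · exact absurd hlt (Nat.not_lt_zero _)

theorem toLex_covBy_succ (p : P) (n : ℕ) :
    (toLex (p, n) : Lex (P × ℕ)) ⋖ toLex (p, n + 1) :=
  Prod.Lex.toLex_covBy_toLex_iff.2 (Or.inl ⟨rfl, Nat.covBy_iff_add_one_eq.2 rfl⟩)

theorem snd_orderIso_apply_zero (F : Lex (P × ℕ) ≃o Lex (Q × ℕ)) (p : P) :
    (ofLex (F (toLex (p, 0)))).2 = 0 := by
  rcases hF : ofLex (F (toLex (p, 0))) with ⟨q, _ | m⟩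
  · rfl
  · have h := toLex_covBy_succ q m
    rw [← hF, toLex_ofLex, ← F.apply_symm_apply (toLex (q, m)), apply_covBy_apply_iff] at h
    exact absurd h (not_covBy_toLex_zero _ _)

theorem orderIso_apply_toLex (F : Lex (P × ℕ) ≃o Lex (Q × ℕ)) (p : P) (n : ℕ) :
    F (toLex (p, n)) = toLex ((ofLex (F (toLex (p, 0)))).1, n) := by
  induction n with
  | zero => exact ofLex.injective (Prod.ext rfl (snd_orderIso_apply_zero F p))
  | succ n ih =>
    have h := (apply_covBy_apply_iff F).2 (toLex_covBy_succ p n)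
    rw [ih] at h
    exact h.unique_right (toLex_covBy_succ _ _)

/-- An isomorphism `P ×ₗ ℕ ≃o Q ×ₗ ℕ` induces an isomorphism `P ≃o Q`. -/
noncomputable def OrderIso.cancelNat (F : Lex (P × ℕ) ≃o Lex (Q × ℕ)) : P ≃o Q :=
  StrictMono.orderIsoOfSurjective (fun p ↦ (ofLex (F (toLex (p, 0)))).1)
    (fun p q hpq ↦ by
      have h : F (toLex (p, 0)) < F (toLex (q, 0)) :=
        F.strictMono (Prod.Lex.lt_iff.2 (Or.inl hpq))
      rw [orderIso_apply_toLex F p, orderIso_apply_toLex F q] at h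
      rcases Prod.Lex.lt_iff.1 h with h | ⟨-, h⟩
      · exact h
      · exact absurd h (lt_irrefl 0))
    (fun q ↦ ⟨(ofLex (F.symm (toLex (q, 0)))).1, by
      dsimp only
      rw [← orderIso_apply_toLex F.symm q 0, F.apply_symm_apply]; rfl⟩)

theorem OrderIso.apply_toLex_eq_cancelNat (F : Lex (P × ℕ) ≃o Lex (Q × ℕ)) (p : P) (n : ℕ) :
    F (toLex (p, n)) = toLex (OrderIso.cancelNat F p, n) :=
  orderIso_apply_toLex F p n

end RightCancel

theorem EventuallyEqTo.orderIso_apply_apply (n : ℕ) : ∀ {s s' : ℕ → ℕ}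
    (F : EventuallyEqTo s ≃o EventuallyEqTo s') (t : EventuallyEqTo s), (F t).1 n = t.1 n := by
  induction n with
  | zero =>
    intro s s' F t
    have h := OrderIso.apply_toLex_eq_cancelNat
      (((tailHead s).symm.trans F).trans (tailHead s')) (ofLex (tailHead s t)).1 (t.1 0)
    have ht : toLex ((ofLex (tailHead s t)).1, t.1 0) = tailHead s t := rfl
    rw [ht] at h
    simp only [OrderIso.trans_apply, OrderIso.symm_apply_apply] at h
    exact congrArg (fun p ↦ (ofLex p).2) h
  | succ n ih =>
    intro s s' F t
    have h := OrderIso.apply_toLex_eq_cancelNat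
      (((tailHead s).symm.trans F).trans (tailHead s')) (ofLex (tailHead s t)).1 (t.1 0)
    have ht : toLex ((ofLex (tailHead s t)).1, t.1 0) = tailHead s t := rfl
    rw [ht] at h
    simp only [OrderIso.trans_apply, OrderIso.symm_apply_apply] at h
    have h' := congrArg (fun p ↦ (ofLex p).1.1 n) h
    exact h'.trans (ih _ _)

theorem EventuallyEqTo.eventuallyEq_of_orderIso {s s' : ℕ → ℕ}
    (F : EventuallyEqTo s ≃o EventuallyEqTo s') : s =ᶠ[atTop] s' := by
  have h := (F ⟨toColex s, EventuallyEq.rfl⟩).2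
  rwa [show ofColex (F ⟨toColex s, EventuallyEq.rfl⟩).1 = s from
    funext fun n ↦ orderIso_apply_apply n F _] at h

/-! ### Closed unbounded sets of preserved cuts -/

section Club

variable {Ω : Type*} [LinearOrder Ω] {X Y : Type*} [LinearOrder X] [LinearOrder Y]

theorem exists_forall_lt_of_lt {F : X ≃o Y} {U : Set X} {V : Set Y}
    (hUV : ∀ x, x ∈ U ↔ F x ∈ V) {ρ : X → Ω} {σ : Y → Ω} (hρ : MonotoneOn ρ U)
    (hσ : MonotoneOn σ V) (hρU : ∀ δ, ∃ x ∈ U, δ < ρ x) (hσV : ∀ δ, ∃ y ∈ V, δ < σ y) (δ : Ω) :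
    ∃ ε, ∀ x ∈ U, ρ x < δ → σ (F x) < ε := by
  obtain ⟨x₀, hx₀, hδ⟩ := hρU δ
  obtain ⟨y, -, hy⟩ := hσV (σ (F x₀))
  refine ⟨σ y, fun x hx hxδ ↦ lt_of_le_of_lt ?_ hy⟩
  refine hσ ((hUV x).1 hx) ((hUV x₀).1 hx₀) (F.monotone (le_of_not_ge fun h ↦ ?_))
  exact absurd (hρ hx₀ hx h) (not_le_of_gt (hxδ.trans hδ))

theorem exists_le_iff_le [WellFoundedLT Ω] [OrderBot Ω]
    (hΩ : ∀ x : ℕ → Ω, BddAbove (Set.range x)) (F : X ≃o Y) {U : Set X} {V : Set Y}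
    (hUV : ∀ x, x ∈ U ↔ F x ∈ V) {ρ : X → Ω} {σ : Y → Ω} (hρ : MonotoneOn ρ U)
    (hσ : MonotoneOn σ V) (hρU : ∀ δ, ∃ x ∈ U, δ < ρ x) (hσV : ∀ δ, ∃ y ∈ V, δ < σ y) :
    ∃ δ, ⊥ < δ ∧ ∀ x ∈ U, δ ≤ ρ x ↔ δ ≤ σ (F x) := by
  have hUV' : ∀ y, y ∈ V ↔ F.symm y ∈ U := fun y ↦ by rw [hUV, F.apply_symm_apply]
  choose e he using exists_forall_lt_of_lt hUV hρ hσ hρU hσV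
  choose e' he' using exists_forall_lt_of_lt (F := F.symm) hUV' hσ hρ hσV hρU
  obtain ⟨x₀, -, hx₀⟩ := hρU ⊥
  let d : ℕ → Ω := fun n ↦ (fun δ ↦ max (e δ) (e' δ))^[n] (ρ x₀)
  have hd : ∀ n, d (n + 1) = max (e (d n)) (e' (d n)) := fun n ↦
    Function.iterate_succ_apply' _ _ _
  have hne : {b | ∀ n, d n ≤ b}.Nonempty := by
    obtain ⟨b, hb⟩ := hΩ d
    exact ⟨b, fun n ↦ hb ⟨n, rfl⟩⟩
  obtain ⟨δ, hδ, hmin⟩ := WellFounded.has_min (wellFounded_lt (α := Ω)) _ hne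
  have hlt : ∀ z, z < δ ↔ ∃ n, z < d n := fun z ↦
    ⟨fun hz ↦ by
      by_contra! hall
      exact hmin z hall hz, fun ⟨n, hn⟩ ↦ hn.trans_le (hδ n)⟩
  refine ⟨δ, hx₀.trans_le (hδ 0), fun x hx ↦ ?_⟩
  rw [← not_lt, ← not_lt, not_iff_not, hlt, hlt]
  constructor
  · rintro ⟨n, hn⟩
    refine ⟨n + 1, (he _ x hx hn).trans_le ?_⟩
    rw [hd]; exact le_max_left _ _
  · rintro ⟨n, hn⟩
    refine ⟨n + 1, ?_⟩
    have := he' _ (F x) ((hUV x).1 hx) hn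
    rw [F.symm_apply_apply] at this
    rw [hd]; exact this.trans_le (le_max_right _ _)

end Club

/-! ### Two-sided long alphabets and preserved words -/

/-- The alphabet: a reversed copy of `Ω` followed by a copy of `Ω`. -/
abbrev TwoSided (Ω : Type*) : Type _ := Lex (Ωᵒᵈ ⊕ Ω)

namespace TwoSided

variable {Ω : Type*} [LinearOrder Ω] [OrderBot Ω]

/-- The letter of the upper half with index `δ`. -/
def up (δ : Ω) : TwoSided Ω := toLex (Sum.inr δ)

/-- The letter of the lower half with index `δ`. -/
def down (δ : Ω) : TwoSided Ω := toLex (Sum.inl (OrderDual.toDual δ))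

/-- `1` on the upper half, `0` on the lower half. -/
def side (a : TwoSided Ω) : ℕ := Sum.elim (fun _ ↦ 0) (fun _ ↦ 1) (ofLex a)

/-- The index in the upper half, `⊥` on the lower half. -/
def upRank (a : TwoSided Ω) : Ω := Sum.elim (fun _ ↦ ⊥) id (ofLex a)

/-- The index in the lower half, `⊥` on the upper half. -/
def downRank (a : TwoSided Ω) : Ω := Sum.elim OrderDual.ofDual (fun _ ↦ ⊥) (ofLex a)

theorem le_upRank_iff {δ : Ω} (hδ : ⊥ < δ) (a : TwoSided Ω) : δ ≤ upRank a ↔ up δ ≤ a := by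
  rcases a with a | a
  · exact iff_of_false (not_le_of_gt hδ) Sum.Lex.not_inr_le_inl
  · exact Sum.Lex.inr_le_inr_iff.symm

theorem le_downRank_iff {δ : Ω} (hδ : ⊥ < δ) (a : TwoSided Ω) :
    δ ≤ downRank a ↔ a ≤ down δ := by
  rcases a with a | a
  · exact (Sum.Lex.inl_le_inl_iff (a := a) (b := OrderDual.toDual δ)).symm
  · exact iff_of_false (not_le_of_gt hδ) Sum.Lex.not_inr_le_inl

theorem upRank_mono : Monotone (upRank : TwoSided Ω → Ω) := by
  intro a b hab
  rcases (bot_le : ⊥ ≤ upRank a).eq_or_lt with h | h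
  · rw [← h]; exact bot_le
  · exact (le_upRank_iff h b).2 (((le_upRank_iff h a).1 le_rfl).trans hab)

theorem downRank_anti : Antitone (downRank : TwoSided Ω → Ω) := by
  intro a b hab
  rcases (bot_le : ⊥ ≤ downRank b).eq_or_lt with h | h
  · exact h.symm.le.trans bot_le
  · exact (le_downRank_iff h a).2 (hab.trans ((le_downRank_iff h b).1 le_rfl))

end TwoSided

/-- `π` assigns words to the points of `X`, monotonically for the lexicographic order, and
every finite word begins some assigned word. -/
structure IsLexMap {X A : Type*} [LinearOrder X] [LinearOrder A] (π : X → ℕ → A) : Prop where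
  apply_le : ∀ {p q : X}, p ≤ q → ∀ {n}, (∀ i < n, π p i = π q i) → π p n ≤ π q n
  exists_agree : ∀ (w : ℕ → A) (n : ℕ), ∃ p, ∀ i ≤ n, π p i = w i

section Preserved

open TwoSided

variable {Ω : Type*} [LinearOrder Ω] {X Y : Type*} [LinearOrder X] [LinearOrder Y]

open Classical in
/-- The rank of the letter at place `n` of a word agreeing with `w` before `n`, and `⊥` for all
other words. -/
noncomputable def rankAfter {A : Type*} [OrderBot Ω] (r : A → Ω) (w : ℕ → A) (n : ℕ) (u : ℕ → A) :
    Ω :=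
  if ∀ i < n, u i = w i then r (u n) else ⊥

theorem rankAfter_of_agree {A : Type*} [OrderBot Ω] {r : A → Ω} {w u : ℕ → A} {n : ℕ}
    (h : ∀ i < n, u i = w i) : rankAfter r w n u = r (u n) :=
  if_pos h

theorem le_rankAfter_iff {A : Type*} [OrderBot Ω] {r : A → Ω} {w u : ℕ → A} {n : ℕ} {δ : Ω}
    (hδ : ⊥ < δ) : δ ≤ rankAfter r w n u ↔ (∀ i < n, u i = w i) ∧ δ ≤ r (u n) := by
  unfold rankAfter
  split_ifs with h
  · exact (and_iff_right h).symm
  · exact iff_of_false (not_le_of_gt hδ) fun h' ↦ h h'.1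

theorem IsLexMap.monotoneOn_rankAfter {A : Type*} [LinearOrder A] [OrderBot Ω] {π : X → ℕ → A}
    (hπ : IsLexMap π) {r : A → Ω} (hr : Monotone r) {w : ℕ → A} {n : ℕ} {U : Set X}
    (hU : ∀ p ∈ U, ∀ q ∈ U, p ≤ q → (∀ i < n, π p i = w i) → ∀ i < n, π q i = w i) :
    MonotoneOn (fun p ↦ rankAfter r w n (π p)) U := by
  intro p hp q hq hpq
  by_cases h : ∀ i < n, π p i = w i
  · have h' := hU p hp q hq hpq h
    simp only [rankAfter_of_agree h, rankAfter_of_agree h']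
    exact hr (hπ.apply_le hpq fun i hi ↦ (h i hi).trans (h' i hi).symm)
  · simp only [rankAfter, if_neg h, bot_le]

theorem IsLexMap.antitoneOn_rankAfter {A : Type*} [LinearOrder A] [OrderBot Ω] {π : X → ℕ → A}
    (hπ : IsLexMap π) {r : A → Ω} (hr : Antitone r) {w : ℕ → A} {n : ℕ} {U : Set X}
    (hU : ∀ p ∈ U, ∀ q ∈ U, p ≤ q → (∀ i < n, π q i = w i) → ∀ i < n, π p i = w i) :
    AntitoneOn (fun p ↦ rankAfter r w n (π p)) U := by
  intro p hp q hq hpq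
  by_cases h : ∀ i < n, π q i = w i
  · have h' := hU p hp q hq hpq h
    simp only [rankAfter_of_agree h, rankAfter_of_agree h']
    exact hr (hπ.apply_le hpq fun i hi ↦ (h' i hi).trans (h i hi).symm)
  · simp only [rankAfter, if_neg h, bot_le]

theorem IsLexMap.exists_agree_and_eq {A : Type*} [LinearOrder A] {π : X → ℕ → A}
    (hπ : IsLexMap π) (w : ℕ → A) (n : ℕ) (a : A) :
    ∃ p, (∀ i < n, π p i = w i) ∧ π p n = a := by
  obtain ⟨p, hp⟩ := hπ.exists_agree (Function.update w n a) n
  exact ⟨p, fun i hi ↦ by simpa [hi.ne] using hp i hi.le, by simpa using hp n le_rfl⟩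

theorem IsLexMap.exists_lt_rankAfter {A : Type*} [LinearOrder A] [OrderBot Ω] [NoMaxOrder Ω]
    {π : X → ℕ → A} (hπ : IsLexMap π) {r : A → Ω} (hr : Function.Surjective r) (w : ℕ → A) (n : ℕ)
    (δ : Ω) : ∃ p, (∀ i < n, π p i = w i) ∧ δ < rankAfter r w n (π p) := by
  obtain ⟨ε, hε⟩ := exists_gt δ
  obtain ⟨a, rfl⟩ := hr ε
  obtain ⟨p, hp, hpn⟩ := hπ.exists_agree_and_eq w n a
  exact ⟨p, hp, by rwa [rankAfter_of_agree hp, hpn]⟩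

variable [OrderBot Ω] [WellFoundedLT Ω] [NoMaxOrder Ω]

theorem exists_up_preserved (hΩ : ∀ x : ℕ → Ω, BddAbove (Set.range x)) (F : X ≃o Y)
    {π : X → ℕ → TwoSided Ω} {σ : Y → ℕ → TwoSided Ω} (hπ : IsLexMap π) (hσ : IsLexMap σ)
    (w : ℕ → TwoSided Ω) (n : ℕ) {U : (ℕ → TwoSided Ω) → Prop}
    (hF : ∀ p, U (π p) ↔ U (σ (F p))) (hw : ∀ u, (∀ i < n, u i = w i) → U u)
    (hπU : ∀ p q, U (π p) → U (π q) → p ≤ q → (∀ i < n, π p i = w i) → ∀ i < n, π q i = w i)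
    (hσU : ∀ p q, U (σ p) → U (σ q) → p ≤ q → (∀ i < n, σ p i = w i) → ∀ i < n, σ q i = w i) :
    ∃ δ, ∀ p, ((∀ i < n, π p i = w i) ∧ up δ ≤ π p n) ↔
      ((∀ i < n, σ (F p) i = w i) ∧ up δ ≤ σ (F p) n) := by
  have hr : Function.Surjective (upRank : TwoSided Ω → Ω) := fun δ ↦ ⟨up δ, rfl⟩
  obtain ⟨δ, hδ, h⟩ := exists_le_iff_le hΩ F (U := {p | U (π p)}) (V := {p | U (σ p)}) hF
    (hπ.monotoneOn_rankAfter upRank_mono fun p hp q hq ↦ hπU p q hp hq)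
    (hσ.monotoneOn_rankAfter upRank_mono fun p hp q hq ↦ hσU p q hp hq)
    (fun δ ↦ (hπ.exists_lt_rankAfter hr w n δ).imp fun p hp ↦ ⟨hw _ hp.1, hp.2⟩)
    (fun δ ↦ (hσ.exists_lt_rankAfter hr w n δ).imp fun p hp ↦ ⟨hw _ hp.1, hp.2⟩)
  refine ⟨δ, fun p ↦ ?_⟩
  by_cases hp : U (π p)
  · rw [← le_upRank_iff hδ, ← le_upRank_iff hδ, ← le_rankAfter_iff hδ, ← le_rankAfter_iff hδ]
    exact h p hp
  · exact iff_of_false (fun h ↦ hp (hw _ h.1)) (fun h ↦ hp ((hF p).2 (hw _ h.1)))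

theorem exists_down_preserved (hΩ : ∀ x : ℕ → Ω, BddAbove (Set.range x)) (F : X ≃o Y)
    {π : X → ℕ → TwoSided Ω} {σ : Y → ℕ → TwoSided Ω} (hπ : IsLexMap π) (hσ : IsLexMap σ)
    (w : ℕ → TwoSided Ω) (n : ℕ) {U : (ℕ → TwoSided Ω) → Prop}
    (hF : ∀ p, U (π p) ↔ U (σ (F p))) (hw : ∀ u, (∀ i < n, u i = w i) → U u)
    (hπU : ∀ p q, U (π p) → U (π q) → p ≤ q → (∀ i < n, π q i = w i) → ∀ i < n, π p i = w i)
    (hσU : ∀ p q, U (σ p) → U (σ q) → p ≤ q → (∀ i < n, σ q i = w i) → ∀ i < n, σ p i = w i) :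
    ∃ δ, ∀ p, ((∀ i < n, π p i = w i) ∧ π p n ≤ down δ) ↔
      ((∀ i < n, σ (F p) i = w i) ∧ σ (F p) n ≤ down δ) := by
  have hr : Function.Surjective (downRank : TwoSided Ω → Ω) := fun δ ↦ ⟨down δ, rfl⟩
  obtain ⟨δ, hδ, h⟩ := exists_le_iff_le hΩ F.dual
    (U := {p | U (π (OrderDual.ofDual p))}) (V := {p | U (σ (OrderDual.ofDual p))}) hF
    (hπ.antitoneOn_rankAfter downRank_anti (U := {p | U (π p)})
      fun p hp q hq ↦ hπU p q hp hq).dual_left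
    (hσ.antitoneOn_rankAfter downRank_anti (U := {p | U (σ p)})
      fun p hp q hq ↦ hσU p q hp hq).dual_left
    (fun δ ↦ (hπ.exists_lt_rankAfter hr w n δ).imp fun p hp ↦ ⟨hw _ hp.1, hp.2⟩)
    (fun δ ↦ (hσ.exists_lt_rankAfter hr w n δ).imp fun p hp ↦ ⟨hw _ hp.1, hp.2⟩)
  refine ⟨δ, fun p ↦ ?_⟩
  by_cases hp : U (π p)
  · rw [← le_downRank_iff hδ, ← le_downRank_iff hδ, ← le_rankAfter_iff hδ, ← le_rankAfter_iff hδ]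
    exact h p hp
  · exact iff_of_false (fun h ↦ hp (hw _ h.1)) (fun h ↦ hp ((hF p).2 (hw _ h.1)))

/-- The words agreeing with `w` before their `n`-th letter, which lies weakly above `w n` for even
`n` and weakly below `w n` for odd `n`; the first argument of the recursion is `n + 1`. -/
def Region {A : Type*} [LE A] (w : ℕ → A) : ℕ → (ℕ → A) → Prop
  | 0, _ => True
  | n + 1, u => (∀ i < n, u i = w i) ∧ if Even n then w n ≤ u n else u n ≤ w n

theorem Region.congr {A : Type*} [LE A] {w w' : ℕ → A} {n : ℕ} (h : ∀ i < n, w i = w' i)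
    {u : ℕ → A} (hu : Region w n u) : Region w' n u := by
  cases n with
  | zero => trivial
  | succ n =>
    refine ⟨fun i hi ↦ (hu.1 i hi).trans (h i (hi.trans n.lt_succ_self)), ?_⟩
    rw [← h n n.lt_succ_self]
    exact hu.2

theorem region_congr {A : Type*} [LE A] {w w' : ℕ → A} {n : ℕ} (h : ∀ i < n, w i = w' i)
    {u : ℕ → A} : Region w n u ↔ Region w' n u :=
  ⟨Region.congr h, Region.congr fun i hi ↦ (h i hi).symm⟩

theorem region_of_agree {A : Type*} [Preorder A] {w u : ℕ → A} {n : ℕ}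
    (h : ∀ i < n, u i = w i) : Region w n u := by
  cases n with
  | zero => trivial
  | succ n =>
    refine ⟨fun i hi ↦ h i (hi.trans n.lt_succ_self), ?_⟩
    rw [h n n.lt_succ_self]
    split_ifs <;> exact le_rfl

theorem Region.agree {A : Type*} [LE A] {w u : ℕ → A} {n m : ℕ} (h : Region w n u) (hm : m < n) :
    ∀ i < m, u i = w i := by
  cases n with
  | zero => exact absurd hm (Nat.not_lt_zero _)
  | succ n => exact fun i hi ↦ h.1 i (hi.trans_le (Nat.le_of_lt_succ hm))

theorem IsLexMap.agree_of_le {A : Type*} [LinearOrder A] {π : X → ℕ → A} (hπ : IsLexMap π)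
    {w : ℕ → A} {n : ℕ} (hn : Even n) {p q : X} (hp : Region w n (π p)) (hq : Region w n (π q))
    (hpq : p ≤ q) (h : ∀ i < n, π p i = w i) : ∀ i < n, π q i = w i := by
  cases n with
  | zero => exact fun i hi ↦ absurd hi (Nat.not_lt_zero _)
  | succ m =>
    have hm := Nat.even_add_one.1 hn
    have hq2 : π q m ≤ w m := by simpa only [if_neg hm] using hq.2
    have hle := hπ.apply_le hpq fun i hi ↦ (hp.1 i hi).trans (hq.1 i hi).symm
    rw [h m m.lt_succ_self] at hle
    intro i hi
    rcases Nat.lt_succ_iff_lt_or_eq.1 hi with hi | rfl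
    · exact hq.1 i hi
    · exact le_antisymm hq2 hle

theorem IsLexMap.agree_of_ge {A : Type*} [LinearOrder A] {π : X → ℕ → A} (hπ : IsLexMap π)
    {w : ℕ → A} {n : ℕ} (hn : ¬ Even n) {p q : X} (hp : Region w n (π p)) (hq : Region w n (π q))
    (hpq : p ≤ q) (h : ∀ i < n, π q i = w i) : ∀ i < n, π p i = w i := by
  cases n with
  | zero => exact fun i hi ↦ absurd hi (Nat.not_lt_zero _)
  | succ m =>
    have hm : Even m := by rwa [Nat.even_add_one, not_not] at hn
    have hp2 : w m ≤ π p m := by simpa only [if_pos hm] using hp.2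
    have hle := hπ.apply_le hpq fun i hi ↦ (hp.1 i hi).trans (hq.1 i hi).symm
    rw [h m m.lt_succ_self] at hle
    intro i hi
    rcases Nat.lt_succ_iff_lt_or_eq.1 hi with hi | rfl
    · exact hp.1 i hi
    · exact le_antisymm hle hp2

theorem region_update_succ {A : Type*} [LE A] {w u : ℕ → A} {n : ℕ} {a : A} :
    Region (Function.update w n a) (n + 1) u ↔
      (∀ i < n, u i = w i) ∧ if Even n then a ≤ u n else u n ≤ a := by
  have h : (∀ i < n, u i = Function.update w n a i) ↔ ∀ i < n, u i = w i :=
    forall₂_congr fun i hi ↦ by rw [Function.update_of_ne hi.ne]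
  simp only [Region, h, Function.update_self]

theorem exists_region_update_preserved (hΩ : ∀ x : ℕ → Ω, BddAbove (Set.range x)) (F : X ≃o Y)
    {π : X → ℕ → TwoSided Ω} {σ : Y → ℕ → TwoSided Ω} (hπ : IsLexMap π) (hσ : IsLexMap σ)
    (w : ℕ → TwoSided Ω) (n : ℕ) (hF : ∀ p, Region w n (π p) ↔ Region w n (σ (F p))) :
    ∃ a : TwoSided Ω, side a = (n + 1) % 2 ∧ ∀ p,
      Region (Function.update w n a) (n + 1) (π p) ↔
        Region (Function.update w n a) (n + 1) (σ (F p)) := by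
  by_cases hn : Even n
  · obtain ⟨δ, hδ⟩ := exists_up_preserved hΩ F hπ hσ w n hF (fun u ↦ region_of_agree)
      (fun p q ↦ hπ.agree_of_le hn) (fun p q ↦ hσ.agree_of_le hn)
    refine ⟨up δ, ?_, fun p ↦ ?_⟩
    · have := Nat.even_iff.1 hn
      change 1 = (n + 1) % 2
      omega
    · rw [region_update_succ, region_update_succ, if_pos hn, if_pos hn]
      exact hδ p
  · obtain ⟨δ, hδ⟩ := exists_down_preserved hΩ F hπ hσ w n hF (fun u ↦ region_of_agree)
      (fun p q ↦ hπ.agree_of_ge hn) (fun p q ↦ hσ.agree_of_ge hn)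
    refine ⟨down δ, ?_, fun p ↦ ?_⟩
    · have := Nat.not_even_iff.1 hn
      change 0 = (n + 1) % 2
      omega
    · rw [region_update_succ, region_update_succ, if_neg hn, if_neg hn]
      exact hδ p

/-- Every isomorphism preserves the fibre over some word whose letters alternate between the two
halves of the alphabet. -/
theorem exists_alternating_fiber_preserved (hΩ : ∀ x : ℕ → Ω, BddAbove (Set.range x)) (F : X ≃o Y)
    {π : X → ℕ → TwoSided Ω} {σ : Y → ℕ → TwoSided Ω} (hπ : IsLexMap π) (hσ : IsLexMap σ) :
    ∃ x : ℕ → TwoSided Ω, (∀ n, side (x n) = (n + 1) % 2) ∧ ∀ p, π p = x ↔ σ (F p) = x := by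
  let P (n : ℕ) (w : ℕ → TwoSided Ω) : Prop := ∀ p, Region w n (π p) ↔ Region w n (σ (F p))
  have hstep : ∀ (n : ℕ) (w : ℕ → TwoSided Ω), ∃ a : TwoSided Ω, P n w →
      side a = (n + 1) % 2 ∧ P (n + 1) (Function.update w n a) := by
    intro n w
    by_cases h : P n w
    · exact (exists_region_update_preserved hΩ F hπ hσ w n h).imp fun a ha _ ↦ ha
    · exact ⟨up ⊥, fun h' ↦ absurd h' h⟩
  choose g hg using hstep
  let W : ℕ → ℕ → TwoSided Ω :=
    Nat.rec (fun _ ↦ up ⊥) fun n w ↦ Function.update w n (g n w)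
  have hW : ∀ n, P n (W n) := by
    intro n
    induction n with
    | zero => exact fun p ↦ Iff.rfl
    | succ n ih => exact (hg n _ ih).2
  have hWx : ∀ n, ∀ i < n, W n i = g i (W i) := by
    intro n
    induction n with
    | zero => exact fun i hi ↦ absurd hi (Nat.not_lt_zero _)
    | succ n ih =>
      intro i hi
      change Function.update (W n) n (g n (W n)) i = _
      rcases Nat.lt_succ_iff_lt_or_eq.1 hi with hi | rfl
      · rw [Function.update_of_ne hi.ne, ih i hi]
      · rw [Function.update_self]
  let x : ℕ → TwoSided Ω := fun n ↦ g n (W n)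
  have hx : ∀ n, P n x := fun n p ↦ by
    rw [← region_congr (hWx n), ← region_congr (hWx n)]
    exact hW n p
  have hfiber : ∀ u : ℕ → TwoSided Ω, u = x ↔ ∀ n, Region x n u := fun u ↦
    ⟨fun h n ↦ region_of_agree fun i _ ↦ congrFun h i,
      fun h ↦ funext fun i ↦ (h (i + 2)).agree (Nat.lt_succ_self _) i (Nat.lt_succ_self _)⟩
  refine ⟨x, fun n ↦ (hg n _ (hW n)).1, fun p ↦ ?_⟩
  rw [hfiber, hfiber]
  exact forall_congr' fun n ↦ hx n p

end Preserved

/-! ### The two orders -/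

section WordPair

open TwoSided

theorem lex_lt_iff_cons {A : Type*} [LinearOrder A] {u v : Lex (ℕ → A)} :
    u < v ↔ u 0 < v 0 ∨
      u 0 = v 0 ∧ toLex (fun n ↦ u (n + 1)) < toLex (fun n ↦ v (n + 1)) := by
  constructor
  · rintro ⟨n, hn, hlt⟩
    cases n with
    | zero => exact Or.inl hlt
    | succ n =>
      exact Or.inr ⟨hn 0 n.succ_pos, n, fun m hm ↦ hn (m + 1) (Nat.succ_lt_succ hm), hlt⟩
  · rintro (hlt | ⟨h, n, hn, hlt⟩)
    · exact ⟨0, fun m hm ↦ absurd hm (Nat.not_lt_zero _), hlt⟩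
    · refine ⟨n + 1, fun m hm ↦ ?_, hlt⟩
      cases m with
      | zero => exact h
      | succ m => exact hn m (Nat.lt_of_succ_lt_succ hm)

theorem TwoSided.side_shift {Ω : Type*} {k l : ℕ} (hkl : k + l = 1) {u : ℕ → TwoSided Ω}
    (hu : (fun n ↦ side (u (n + 2))) =ᶠ[atTop] fun n ↦ side (u n)) :
    (fun n ↦ side (u (n + k))) =ᶠ[atTop] fun n ↦ side (u (n + (l + 1))) := by
  obtain ⟨rfl, rfl⟩ | ⟨rfl, rfl⟩ : k = 0 ∧ l = 1 ∨ k = 1 ∧ l = 0 := by omega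
  · exact hu.symm
  · exact EventuallyEq.rfl

variable {Ω : Type*} [LinearOrder Ω]

/-- Pairs of a word whose sides are eventually `2`-periodic and a sequence eventually equal to the
`k`-shift of these sides. Words are compared lexicographically, then sequences by the last place
where they differ. -/
abbrev WordPair (Ω : Type*) [LinearOrder Ω] (k : ℕ) : Type _ :=
  {p : Lex (Lex (ℕ → TwoSided Ω) × Colex (ℕ → ℕ)) //
    (fun n ↦ side ((ofLex p).1 (n + 2))) =ᶠ[atTop] (fun n ↦ side ((ofLex p).1 n)) ∧
      ofColex (ofLex p).2 =ᶠ[atTop] fun n ↦ side ((ofLex p).1 (n + k))}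

namespace WordPair

/-- The word of a pair. -/
def word {k : ℕ} (p : WordPair Ω k) : ℕ → TwoSided Ω := ofLex (ofLex p.1).1

noncomputable instance linearOrder (k : ℕ) : LinearOrder (WordPair Ω k) where
  le_total p q := by
    rcases lt_trichotomy (ofLex p.1).1 (ofLex q.1).1 with h | h | h
    · exact Or.inl (Prod.Lex.le_iff.2 (Or.inl h))
    · have hpq : ofColex (ofLex p.1).2 =ᶠ[atTop] ofColex (ofLex q.1).2 := by
        have := p.2.2
        rw [h] at this
        exact this.trans q.2.2.symm
      exact (colex_le_total hpq).imp (fun h' ↦ Prod.Lex.le_iff.2 (Or.inr ⟨h, h'⟩))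
        fun h' ↦ Prod.Lex.le_iff.2 (Or.inr ⟨h.symm, h'⟩)
    · exact Or.inr (Prod.Lex.le_iff.2 (Or.inl h))
  toDecidableLE := Classical.decRel _

/-- Splitting off the first term of the sequence of a pair. -/
noncomputable def sequenceTailHead {k l : ℕ} (hkl : k + l = 1) :
    WordPair Ω k ≃o Lex (WordPair Ω l × ℕ) :=
  StrictMono.orderIsoOfSurjective
    (fun p ↦ toLex (⟨toLex ((ofLex p.1).1, toColex fun n ↦ (ofLex p.1).2 (n + 1)), p.2.1, by
      refine (eventuallyEq_tail_iff.2 p.2.2).trans ?_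
      simp only [add_assoc, add_comm 1]
      exact (side_shift (by omega) p.2.1).symm⟩, (ofLex p.1).2 0))
    (fun p q hpq ↦ by
      rcases Prod.Lex.lt_iff.1 (show p.1 < q.1 from hpq) with h | ⟨h, h'⟩
      · exact Prod.Lex.lt_iff.2 (Or.inl (Prod.Lex.lt_iff.2 (Or.inl h)))
      · rcases colex_lt_iff_tail.1 h' with h' | ⟨h', h0⟩
        · exact Prod.Lex.lt_iff.2 (Or.inl (Prod.Lex.lt_iff.2 (Or.inr ⟨h, h'⟩)))
        · exact Prod.Lex.lt_iff.2 (Or.inr ⟨Subtype.ext (congrArg toLex (Prod.ext h h')), h0⟩))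
    (fun ⟨⟨p, hp, hp'⟩, m⟩ ↦ ⟨⟨toLex ((ofLex p).1, toColex fun n ↦
        Nat.casesOn n m fun i ↦ (ofLex p).2 i), hp, by
      refine eventuallyEq_tail_iff.1 (hp'.trans ?_)
      simp only [add_assoc, add_comm 1]
      exact side_shift (by omega) hp⟩, rfl⟩)

/-- Splitting off the first letter of the word of a pair. -/
noncomputable def wordHeadTail {k l : ℕ} (hkl : k + l = 1) :
    WordPair Ω k ≃o Lex (TwoSided Ω × WordPair Ω l) :=
  StrictMono.orderIsoOfSurjective
    (fun p ↦ toLex ((ofLex p.1).1 0,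
      ⟨toLex (toLex fun n ↦ (ofLex p.1).1 (n + 1), (ofLex p.1).2),
        eventuallyEq_tail_iff.2 p.2.1, p.2.2.trans (side_shift hkl p.2.1)⟩))
    (fun p q hpq ↦ by
      rcases Prod.Lex.lt_iff.1 (show p.1 < q.1 from hpq) with h | ⟨h, h'⟩
      · rcases lex_lt_iff_cons.1 h with h | ⟨h, h'⟩
        · exact Prod.Lex.lt_iff.2 (Or.inl h)
        · exact Prod.Lex.lt_iff.2 (Or.inr ⟨h, Prod.Lex.lt_iff.2 (Or.inl h')⟩)
      · refine Prod.Lex.lt_iff.2 (Or.inr ⟨congrFun h 0, Prod.Lex.lt_iff.2 (Or.inr ⟨?_, h'⟩)⟩)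
        exact funext fun n ↦ congrFun h (n + 1))
    (fun ⟨a, p, hp, hp'⟩ ↦ by
      let u : ℕ → TwoSided Ω := fun n ↦ Nat.casesOn n a fun i ↦ (ofLex p).1 i
      have hu : (fun n ↦ side (u (n + 2))) =ᶠ[atTop] fun n ↦ side (u n) :=
        eventuallyEq_tail_iff.1 hp
      exact ⟨⟨toLex (toLex u, (ofLex p).2), hu, hp'.trans (side_shift hkl hu).symm⟩, rfl⟩)

theorem isLexMap_word (k : ℕ) : IsLexMap (word : WordPair Ω k → ℕ → TwoSided Ω) where
  apply_le {p q} hpq n h :=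
    Pi.apply_le_of_toLex (Prod.Lex.monotone_fst _ _ (show p.1 ≤ q.1 from hpq)) h
  exists_agree w n := by
    let u : ℕ → TwoSided Ω := fun i ↦ if i ≤ n then w i else w 0
    refine ⟨⟨toLex (toLex u, toColex fun i ↦ side (u (i + k))), ?_, EventuallyEq.rfl⟩,
      fun i hi ↦ if_pos hi⟩
    filter_upwards [eventually_gt_atTop n] with i hi
    change side (u (i + 2)) = side (u i)
    simp only [u, if_neg (not_le_of_gt hi), if_neg (show ¬ i + 2 ≤ n by omega)]

/-- The sequences paired with a given word. -/
noncomputable def fiber (k : ℕ) {x : ℕ → TwoSided Ω}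
    (hx : (fun n ↦ side (x (n + 2))) =ᶠ[atTop] fun n ↦ side (x n)) :
    EventuallyEqTo (fun n ↦ side (x (n + k))) ≃o {p : WordPair Ω k // word p = x} :=
  StrictMono.orderIsoOfSurjective (fun t ↦ ⟨⟨toLex (toLex x, t.1), hx, t.2⟩, rfl⟩)
    (fun _ _ hst ↦ Prod.Lex.lt_iff.2 (Or.inr ⟨rfl, hst⟩))
    (by
      rintro ⟨⟨p, hp, hp'⟩, rfl⟩
      exact ⟨⟨(ofLex p).2, hp'⟩, rfl⟩)

theorem isEmpty_orderIso [OrderBot Ω] [WellFoundedLT Ω] [NoMaxOrder Ω]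
    (hΩ : ∀ x : ℕ → Ω, BddAbove (Set.range x)) : IsEmpty (WordPair Ω 0 ≃o WordPair Ω 1) := by
  refine ⟨fun F ↦ ?_⟩
  obtain ⟨x, hx, hF⟩ :=
    exists_alternating_fiber_preserved hΩ F (isLexMap_word 0) (isLexMap_word 1)
  have hper : (fun n ↦ side (x (n + 2))) =ᶠ[atTop] fun n ↦ side (x n) :=
    .of_eq (funext fun n ↦ by rw [hx, hx]; omega)
  let G : {p : WordPair Ω 0 // word p = x} ≃o {p : WordPair Ω 1 // word p = x} :=
    ⟨F.toEquiv.subtypeEquiv hF, F.map_rel_iff⟩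
  obtain ⟨n, hn⟩ := (EventuallyEqTo.eventuallyEq_of_orderIso
    (((fiber 0 hper).trans G).trans (fiber 1 hper).symm)).exists
  simp only [hx] at hn
  omega

end WordPair

end WordPair

/-! ### The first uncountable ordinal -/

open Ordinal in
theorem bddAbove_range_omega_one (x : ℕ → (ω_ 1).ToType) : BddAbove (Set.range x) := by
  let f : ℕ → Ordinal := fun n ↦ (ToType.mk.symm (x n)).1
  have hf : ⨆ n, f n < ω_ 1 := iSup_lt_omega_one fun n ↦ (ToType.mk.symm (x n)).2
  refine ⟨ToType.mk ⟨_, hf⟩, ?_⟩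
  rintro _ ⟨n, rfl⟩
  rw [← ToType.mk.symm.le_iff_le, OrderIso.symm_apply_apply]
  exact Ordinal.le_iSup f n

open Ordinal in
instance noMaxOrder_omega_one : NoMaxOrder (ω_ 1).ToType where
  exists_gt a := by
    have h := (Cardinal.isSuccLimit_omega 1).succ_lt (Set.mem_Iio.1 (ToType.mk.symm a).2)
    refine ⟨ToType.mk ⟨_, Set.mem_Iio.2 h⟩, ?_⟩
    rw [← ToType.mk.symm.lt_iff_lt, OrderIso.symm_apply_apply]
    exact Order.lt_succ (ToType.mk.symm a).1

/-- There exist non-isomorphic linear orders `X`, `Y` that are both left-hand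
and right-hand divisors of one another: `X ≅ A ×ₗ Y`, `Y ≅ A' ×ₗ X`,
`X ≅ Y ×ₗ B`, `Y ≅ X ×ₗ B'` for some linear orders `A`, `A'`, `B`, `B'`. -/
theorem exists_nonIso_mutual_left_and_right_divisors :
    ∃ (X Y : Type) (_ : LinearOrder X) (_ : LinearOrder Y),
      IsEmpty (X ≃o Y) ∧
      ∃ (A A' B B' : Type) (_ : LinearOrder A) (_ : LinearOrder A')
        (_ : LinearOrder B) (_ : LinearOrder B'),
        Nonempty (X ≃o Lex (A × Y)) ∧
        Nonempty (Y ≃o Lex (A' × X)) ∧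
        Nonempty (X ≃o Lex (Y × B)) ∧
        Nonempty (Y ≃o Lex (X × B')) := by
  have : Nonempty (Ordinal.omega 1).ToType :=
    Ordinal.nonempty_toType_iff.2 (Ordinal.omega_pos 1).ne'
  let : OrderBot (Ordinal.omega 1).ToType := WellFoundedLT.toOrderBot _
  exact ⟨WordPair (Ordinal.omega 1).ToType 0, WordPair (Ordinal.omega 1).ToType 1,
    inferInstance, inferInstance, WordPair.isEmpty_orderIso bddAbove_range_omega_one,
    TwoSided (Ordinal.omega 1).ToType, TwoSided (Ordinal.omega 1).ToType, ℕ, ℕ,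
    inferInstance, inferInstance, inferInstance, inferInstance,
    ⟨WordPair.wordHeadTail rfl⟩, ⟨WordPair.wordHeadTail rfl⟩,
    ⟨WordPair.sequenceTailHead rfl⟩, ⟨WordPair.sequenceTailHead rfl⟩⟩
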